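/- (Uniqueness of approximate Taylor polynomials.) Let D ⊆ ℝ^n be measurable, f : D → ℝ measurable, k a positive integer, and x₀ ∈ D a point at which D has density one. Suppose p and q are both polynomial functions ℝ^n → ℝ of degree at most k−1 such that f has an approximate (k−1)-Taylor polynomial at x₀ with polynomial p, and also with polynomial q. Then p = q. (This is part (1) of the paper's Proposition 3.3 specialized to the abelian Carnot group ℝ^n.) -/

import Mathlib

open MeasureTheory Metric Filter

noncomputable section

/-- `ℝ^n` with the Euclidean norm. -/
abbrev Euc (n : ℕ) := EuclideanSpace ℝ (Fin n)

/-- A set `S ⊆ ℝ^n` has density one at `x` if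
`vol(S ∩ B(x,r))/vol(B(x,r)) → 1` as `r → 0⁺`. -/
def DensityOneAt {n : ℕ} (S : Set (Euc n)) (x : Euc n) : Prop :=
  Tendsto (fun r : ℝ => volume (S ∩ ball x r) / volume (ball x r))
    (nhdsWithin 0 (Set.Ioi 0)) (nhds 1)

/-- A set has density zero at `x` if its complement has density one at `x`. -/
def DensityZeroAt {n : ℕ} (S : Set (Euc n)) (x : Euc n) : Prop :=
  DensityOneAt Sᶜ x

/-- Degree `|J|` of a multi-index. -/
def mdeg {n : ℕ} (J : Fin n → ℕ) : ℕ := ∑ i, J i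

/-- Monomial `x^J = x₁^{j₁} ⋯ xₙ^{jₙ}`. -/
def mpow {n : ℕ} (x : Euc n) (J : Fin n → ℕ) : ℝ := ∏ i, (x i) ^ (J i)

/-- `J! = j₁! ⋯ jₙ!`. -/
def Jfact {n : ℕ} (J : Fin n → ℕ) : ℕ := ∏ i, Nat.factorial (J i)

/-- `p : ℝ^n → ℝ` is a polynomial function of (total) degree at most `k`. -/
def IsPolyFun (n k : ℕ) (p : Euc n → ℝ) : Prop :=
  ∃ P : MvPolynomial (Fin n) ℝ, P.totalDegree ≤ k ∧
    ∀ x : Euc n, p x = MvPolynomial.eval (fun i => x i) P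

/-- `f : D → ℝ` is approximately differentiable of order `k` at `x₀` (a density point
of `D`) with polynomial `p`: `p` has degree at most `k` and for every `ε > 0` the set
`{x ∈ D : |f x − p x| > ε ‖x − x₀‖^k}` has density zero at `x₀`. -/
def ApproxDiffAt {n : ℕ} (k : ℕ) (D : Set (Euc n)) (f : Euc n → ℝ)
    (x₀ : Euc n) (p : Euc n → ℝ) : Prop :=
  DensityOneAt D x₀ ∧ IsPolyFun n k p ∧
    ∀ ε : ℝ, 0 < ε →
      DensityZeroAt {x | x ∈ D ∧ ε * ‖x - x₀‖ ^ k < |f x - p x|} x₀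

/-- `f : D → ℝ` has an approximate `(k−1)`-Taylor polynomial at `x₀` (a density point
of `D`) with polynomial `p`: `p` has degree at most `k−1` and there is `M > 0` such that
`{x ∈ D : |f x − p x| > M ‖x − x₀‖^k}` has density zero at `x₀`. -/
def HasApproxTaylorAt {n : ℕ} (k : ℕ) (D : Set (Euc n)) (f : Euc n → ℝ)
    (x₀ : Euc n) (p : Euc n → ℝ) : Prop :=
  DensityOneAt D x₀ ∧ IsPolyFun n (k - 1) p ∧
    ∃ M : ℝ, 0 < M ∧
      DensityZeroAt {x | x ∈ D ∧ M * ‖x - x₀‖ ^ k < |f x - p x|} x₀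

/-- The finset of multi-indices `J` with `|J| ≤ k`. -/
def multiIdxLe (n k : ℕ) : Finset (Fin n → ℕ) :=
  (Fintype.piFinset fun _ : Fin n => Finset.range (k+1)).filter fun J => mdeg J ≤ k

/-- The finset of multi-indices `J` with `|J| < k` (i.e. `|J| ≤ k−1`). -/
def multiIdxLt (n k : ℕ) : Finset (Fin n → ℕ) :=
  (Fintype.piFinset fun _ : Fin n => Finset.range (k+1)).filter fun J => mdeg J < k

/-- Partial derivative `∂g/∂xᵢ` (as a line derivative in the direction `eᵢ`). -/
def pd {n : ℕ} (i : Fin n) (g : Euc n → ℝ) : Euc n → ℝ :=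
  fun x => lineDeriv ℝ g x (EuclideanSpace.single i 1)

/-- The list of directions `(1,…,1,2,…,2,…)` (direction `i` repeated `J i` times)
encoding the iterated partial derivative `∂^{|J|}/∂x₁^{j₁}⋯∂xₙ^{jₙ}`. -/
def multiList (n : ℕ) (J : Fin n → ℕ) : List (Fin n) :=
  (List.finRange n).flatMap fun i => List.replicate (J i) i

/-- Iterated partial derivatives along a list of coordinate directions
(the head of the list is the outermost derivative). -/
def iterD {n : ℕ} : List (Fin n) → (Euc n → ℝ) → (Euc n → ℝ)
  | [], g => g
  | i :: L, g => pd i (iterD L g)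

/-- The iterated partial derivatives along the list `L` all exist at every point. -/
def iterDExists {n : ℕ} : List (Fin n) → (Euc n → ℝ) → Prop
  | [], _ => True
  | i :: L, g => iterDExists L g ∧
      ∀ x : Euc n, LineDifferentiableAt ℝ (iterD L g) x (EuclideanSpace.single i 1)

/-- `D^J u = ∂^{|J|}u/∂x₁^{j₁}⋯∂xₙ^{jₙ}`. -/
def DJ {n : ℕ} (J : Fin n → ℕ) (u : Euc n → ℝ) : Euc n → ℝ := iterD (multiList n J) u

/-- The Taylor polynomial of `u` of degree `k−1` centered at `x₀`:
`P_{x₀}(y) = Σ_{|I| ≤ k−1} D^I u(x₀) (y − x₀)^I / I!`. -/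
def TaylorPoly {n : ℕ} (k : ℕ) (u : Euc n → ℝ) (x₀ : Euc n) : Euc n → ℝ :=
  fun y => ∑ I ∈ multiIdxLt n k, DJ I u x₀ * mpow (y - x₀) I / (Jfact I : ℝ)

/-- `u` belongs to `Lip(k, ℝ^n)` with constant `M`: all partial derivatives `D^J u`
with `|J| ≤ k−1` exist at every point, and for all such `J` and all `x, x₀`,
`|D^J u(x₀)| ≤ M` and `|D^J u(x) − D^J P_{x₀}(x)| ≤ M ‖x − x₀‖^{k−|J|}`. -/
def MemLip (n k : ℕ) (M : ℝ) (u : Euc n → ℝ) : Prop :=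
  (∀ J : Fin n → ℕ, mdeg J < k → iterDExists (multiList n J) u) ∧
  ∀ J : Fin n → ℕ, mdeg J < k → ∀ x x₀ : Euc n,
    |DJ J u x₀| ≤ M ∧
    |DJ J u x - DJ J (TaylorPoly k u x₀) x| ≤ M * ‖x - x₀‖ ^ (k - mdeg J)

/-- Truncation of `f` at level `h`: equals `f` where `−h < f < h`, equals `h` where
`f ≥ h`, and equals `−h` where `f ≤ −h`. -/
def trunc {n : ℕ} (h : ℕ) (f : Euc n → ℝ) : Euc n → ℝ :=
  fun x => if (h : ℝ) ≤ f x then (h : ℝ) else if f x ≤ -(h : ℝ) then -(h : ℝ) else f x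



/-- Scaling a homogeneous polynomial. -/
lemma eval_smul_homog {n j : ℕ} (φ : MvPolynomial (Fin n) ℝ) (h : φ.IsHomogeneous j)
    (r : ℝ) (y : Fin n → ℝ) :
    MvPolynomial.eval (fun i => r * y i) φ = r ^ j * MvPolynomial.eval y φ := by
  rw [MvPolynomial.eval_eq, MvPolynomial.eval_eq, Finset.mul_sum]
  refine Finset.sum_congr rfl fun d hd => ?_
  have h1 : d.degree = j := by
    rw [Finsupp.degree_eq_weight_one]
    exact h (MvPolynomial.mem_support_iff.mp hd)
  simp only [mul_pow, Finset.prod_mul_distrib, Finset.prod_pow_eq_pow_sum]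
  rw [← h1, Finsupp.degree_apply]
  ring

/-- Translating a polynomial does not increase its degree. -/
lemma exists_translate {n k : ℕ} (P : MvPolynomial (Fin n) ℝ) (hP : P.totalDegree ≤ k)
    (a : Fin n → ℝ) : ∃ T : MvPolynomial (Fin n) ℝ, T.totalDegree ≤ k ∧
      ∀ y, MvPolynomial.eval y T = MvPolynomial.eval (fun i => a i + y i) P := by
  refine ⟨∑ d ∈ P.support, MvPolynomial.C (P.coeff d) *
    ∏ i ∈ d.support, (MvPolynomial.C (a i) + MvPolynomial.X i) ^ d i, ?_, ?_⟩
  · refine MvPolynomial.totalDegree_finsetSum_le fun d hd => ?_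
    refine (MvPolynomial.totalDegree_mul _ _).trans ?_
    rw [MvPolynomial.totalDegree_C, zero_add]
    refine (MvPolynomial.totalDegree_finsetProd _ _).trans ?_
    refine le_trans ?_ ((MvPolynomial.le_totalDegree hd).trans hP)
    refine Finset.sum_le_sum fun i _ => ?_
    refine (MvPolynomial.totalDegree_pow _ _).trans ?_
    have : (MvPolynomial.C (a i) + MvPolynomial.X i :
        MvPolynomial (Fin n) ℝ).totalDegree ≤ 1 := by
      refine (MvPolynomial.totalDegree_add _ _).trans ?_
      simp
    nlinarith [Nat.zero_le (d i)]
  · intro y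
    rw [MvPolynomial.eval_eq (f := P)]
    simp [map_sum, map_prod]

/-- Leading behaviour at the origin. -/
lemma exists_lead {n k : ℕ} (T : MvPolynomial (Fin n) ℝ) (hT : T.totalDegree < k)
    (hT0 : T ≠ 0) : ∃ m < k, ∃ H : ℕ → MvPolynomial (Fin n) ℝ, H 0 ≠ 0 ∧
      ∀ (r : ℝ) (y : Fin n → ℝ), MvPolynomial.eval (fun i => r * y i) T =
        r ^ m * ∑ j ∈ Finset.range (k - m), r ^ j * MvPolynomial.eval y (H j) := by
  classical
  have hsum : ∑ i ∈ Finset.range (T.totalDegree + 1), T.homogeneousComponent i = T :=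
    MvPolynomial.sum_homogeneousComponent T
  have hsumk : ∑ i ∈ Finset.range k, T.homogeneousComponent i = T := by
    conv_rhs => rw [← hsum]
    symm
    refine Finset.sum_subset (by simpa using hT) fun i _ hi => ?_
    apply MvPolynomial.homogeneousComponent_eq_zero
    simp at hi
    omega
  have hex : ∃ i, T.homogeneousComponent i ≠ 0 := by
    by_contra! hc
    exact hT0 (by rw [← hsumk]; exact Finset.sum_eq_zero fun i _ => hc i)
  set m := Nat.find hex with hm
  have hm0 : T.homogeneousComponent m ≠ 0 := Nat.find_spec hex
  have hmlt : ∀ i < m, T.homogeneousComponent i = 0 := fun i hi => by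
    by_contra hc
    exact Nat.find_min hex hi hc
  have hmk : m < k := by
    by_contra hc
    exact hm0 (MvPolynomial.homogeneousComponent_eq_zero _ _ (by omega))
  refine ⟨m, hmk, fun j => T.homogeneousComponent (m + j), by simpa using hm0, fun r y => ?_⟩
  conv_lhs => rw [← hsumk]
  rw [map_sum]
  simp_rw [eval_smul_homog _ (MvPolynomial.homogeneousComponent_isHomogeneous _ T)]
  obtain ⟨l, rfl⟩ := Nat.exists_eq_add_of_lt hmk
  rw [show m + l + 1 = m + (l + 1) by ring, Finset.sum_range_add, Finset.sum_eq_zero, zero_add,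
    Nat.add_sub_cancel_left, Finset.mul_sum]
  · refine Finset.sum_congr rfl fun j _ => ?_
    ring
  · intro i hi
    rw [hmlt i (by simpa using hi)]
    simp

/-- The complement of a measurable set of density one has relative measure going to `0`. -/
lemma compl_ratio {n : ℕ} {S : Set (Euc n)} {x : Euc n} (hS : MeasurableSet S)
    (h : DensityOneAt S x) :
    Tendsto (fun r : ℝ => volume (Sᶜ ∩ ball x r) / volume (ball x r))
      (nhdsWithin 0 (Set.Ioi 0)) (nhds 0) := by
  have h1 := ENNReal.Tendsto.sub (tendsto_const_nhds (x := (1 : ENNReal))) h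
    (Or.inl ENNReal.one_ne_top)
  rw [tsub_self] at h1
  refine h1.congr' ?_
  filter_upwards [self_mem_nhdsWithin] with r hr
  have hr : 0 < r := hr
  have hb : volume (ball x r) ≠ 0 := (measure_ball_pos volume x hr).ne'
  have hb' : volume (ball x r) ≠ ⊤ := measure_ball_lt_top.ne
  have hadd : volume (S ∩ ball x r) + volume (Sᶜ ∩ ball x r) = volume (ball x r) := by
    rw [Set.inter_comm S, Set.inter_comm Sᶜ, ← Set.diff_eq]
    exact measure_inter_add_diff _ hS
  have h2 : volume (S ∩ ball x r) / volume (ball x r)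
      + volume (Sᶜ ∩ ball x r) / volume (ball x r) = 1 := by
    rw [← ENNReal.add_div, hadd, ENNReal.div_self hb hb']
  have h3 : volume (S ∩ ball x r) / volume (ball x r) ≠ ⊤ := by
    intro h4
    rw [h4, top_add] at h2
    exact ENNReal.top_ne_one h2
  rw [← h2, ENNReal.add_sub_cancel_left h3]

/-- The bad sets are measurable. -/
lemma meas_bad {n k : ℕ} {D : Set (Euc n)} (hD : MeasurableSet D)
    {f : Euc n → ℝ} (hf : Measurable (D.restrict f)) {x₀ : Euc n} {p : Euc n → ℝ}
    (hp : Continuous p) (M : ℝ) :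
    MeasurableSet {x | x ∈ D ∧ M * ‖x - x₀‖ ^ k < |f x - p x|} := by
  have h1 : MeasurableSet {z : D | M * ‖(z : Euc n) - x₀‖ ^ k < |D.restrict f z - p z|} := by
    apply measurableSet_lt
    · exact (by fun_prop : Continuous fun x : Euc n => M * ‖x - x₀‖ ^ k).measurable.comp
        measurable_subtype_coe
    · exact continuous_abs.measurable.comp
        (hf.sub (hp.measurable.comp measurable_subtype_coe))
  convert hD.subtype_image h1 using 1
  ext x
  simp only [Set.mem_image, Subtype.exists, exists_and_right, exists_eq_right]
  exact ⟨fun h => ⟨h.1, h.2⟩, fun ⟨h, h'⟩ => ⟨h, h'⟩⟩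

lemma poly_cont {n : ℕ} (P : MvPolynomial (Fin n) ℝ) :
    Continuous fun x : Euc n => MvPolynomial.eval (fun i => x i) P :=
  (MvPolynomial.continuous_eval P).comp (by fun_prop)

/-- **Proposition 3.3(1)** (abelian case): uniqueness of approximate
`(k−1)`-Taylor polynomials. -/
theorem stmt7 (n : ℕ) (hn : 0 < n) (D : Set (Euc n)) (hD : MeasurableSet D)
    (f : Euc n → ℝ) (hf : Measurable (D.restrict f)) (k : ℕ) (hk : 0 < k)
    (x₀ : Euc n) (hx₀ : x₀ ∈ D) (hdens : DensityOneAt D x₀)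
    (p q : Euc n → ℝ)
    (hp : HasApproxTaylorAt k D f x₀ p) (hq : HasApproxTaylorAt k D f x₀ q) :
    p = q := by
  obtain ⟨-, ⟨P, hPd, hPe⟩, M₁, hM₁, h₁⟩ := hp
  obtain ⟨-, ⟨Q, hQd, hQe⟩, M₂, hM₂, h₂⟩ := hq
  have hpc : Continuous p := by
    rw [show p = _ from funext hPe]
    exact poly_cont P
  have hqc : Continuous q := by
    rw [show q = _ from funext hQe]
    exact poly_cont Q
  have c0 := compl_ratio hD hdens
  have c1 := compl_ratio (meas_bad hD hf hpc M₁).compl h₁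
  have c2 := compl_ratio (meas_bad hD hf hqc M₂).compl h₂
  have c := (c0.add c1).add c2
  simp only [add_zero] at c
  by_contra hne
  obtain ⟨T, hTd, hTe⟩ := exists_translate (P - Q)
    ((MvPolynomial.totalDegree_sub _ _).trans (max_le hPd hQd)) (fun i => x₀ i)
  have hT0 : T ≠ 0 := by
    rintro rfl
    apply hne
    funext x
    have := hTe (fun i => x i - x₀ i)
    simp only [map_zero, add_sub_cancel, map_sub] at this
    rw [hPe, hQe]
    linarith
  obtain ⟨m, hmk, H, hH0, hH⟩ := exists_lead T (by omega : T.totalDegree < k) hT0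
  have hy : ∃ y : Fin n → ℝ, MvPolynomial.eval y (H 0) ≠ 0 := by
    by_contra! hc
    exact hH0 (MvPolynomial.funext fun y => by simpa using hc y)
  obtain ⟨y₀', hy₀'⟩ := hy
  set y₀ : Euc n := WithLp.toLp 2 y₀' with hy₀def
  let F : ℝ × Euc n → ℝ := fun z =>
    ∑ j ∈ Finset.range (k - m), z.1 ^ j * MvPolynomial.eval (fun i => z.2 i) (H j)
  have hFc : Continuous F := by
    refine continuous_finsetSum _ fun j _ => ?_
    exact (continuous_fst.pow j).mul ((poly_cont (H j)).comp continuous_snd)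
  let R : ℝ × Euc n → ℝ := fun z => (M₁ + M₂) * (z.1 ^ (k - m) * ‖z.2‖ ^ k)
  have hRc : Continuous R := by fun_prop
  have hF0 : F (0, y₀) = MvPolynomial.eval y₀' (H 0) := by
    obtain ⟨l, hl⟩ : ∃ l, k - m = l + 1 := ⟨k - m - 1, by omega⟩
    simp only [F, hl, Finset.sum_range_succ']
    simp [y₀]
  have hopen : IsOpen {z | R z < |F z|} := isOpen_lt hRc hFc.abs
  have hmem : ((0 : ℝ), y₀) ∈ {z | R z < |F z|} := by
    simp only [Set.mem_setOf_eq, hF0]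
    have : R (0, y₀) = 0 := by
      simp [R, zero_pow (by omega : k - m ≠ 0)]
    rw [this]
    exact abs_pos.mpr hy₀'
  obtain ⟨δ, hδ, hball⟩ := Metric.isOpen_iff.mp hopen _ hmem
  set ρ := ‖y₀‖ + δ with hρdef
  have hρ : 0 < ρ := by positivity
  have hlow : ∀ r : ℝ, 0 < r → r < δ → ball (x₀ + r • y₀) (r * δ) ⊆
      (Dᶜ ∪ {x | x ∈ D ∧ M₁ * ‖x - x₀‖ ^ k < |f x - p x|} ∪
        {x | x ∈ D ∧ M₂ * ‖x - x₀‖ ^ k < |f x - q x|}) ∩ ball x₀ (r * ρ) := by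
    intro r hr hrδ x hx
    set y : Euc n := r⁻¹ • (x - x₀) with hydef
    have hxy : x - x₀ = r • y := by
      rw [hydef, smul_smul, mul_inv_cancel₀ hr.ne', one_smul]
    have hyd : ‖y - y₀‖ < δ := by
      have h3 : ‖x - (x₀ + r • y₀)‖ < r * δ := by simpa [dist_eq_norm] using hx
      rw [show x - (x₀ + r • y₀) = r • (y - y₀) by rw [smul_sub, ← hxy]; abel,
        norm_smul, Real.norm_of_nonneg hr.le] at h3
      exact lt_of_mul_lt_mul_left h3 hr.le
    have hlt : R (r, y) < |F (r, y)| := by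
      apply hball
      rw [mem_ball, Prod.dist_eq, max_lt_iff]
      refine ⟨?_, ?_⟩
      · simpa [abs_of_pos hr] using hrδ
      · simpa [dist_eq_norm] using hyd
    have hdiff : p x - q x = r ^ m * F (r, y) := by
      have e1 := hTe (fun i => r * y i)
      rw [hH] at e1
      have e2 : (fun i => x₀ i + r * y i) = fun i => x i := by
        funext i
        have := congrArg (fun v : Euc n => v i) hxy
        simp at this
        linarith
      rw [e2, map_sub, ← hPe, ← hQe] at e1
      exact e1.symm
    have hbig : (M₁ + M₂) * ‖x - x₀‖ ^ k < |p x - q x| := by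
      rw [hdiff, abs_mul, abs_of_pos (pow_pos hr m), hxy, norm_smul,
        Real.norm_of_nonneg hr.le, mul_pow]
      have e3 : r ^ k = r ^ m * r ^ (k - m) := by
        rw [← pow_add]
        congr 1
        omega
      calc (M₁ + M₂) * (r ^ k * ‖y‖ ^ k) = r ^ m * R (r, y) := by
            simp only [R]
            rw [e3]
            ring
        _ < _ := mul_lt_mul_of_pos_left hlt (pow_pos hr m)
    refine ⟨?_, ?_⟩
    · by_contra hcon
      simp only [Set.mem_union, Set.mem_compl_iff, Set.mem_setOf_eq, not_or, not_not,
        not_and, not_lt] at hcon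
      obtain ⟨⟨hxD, ha⟩, hb⟩ := hcon
      have ha := ha hxD
      have hb := hb hxD
      have : |p x - q x| ≤ |f x - p x| + |f x - q x| := by
        rw [abs_sub_comm (f x) (p x)]
        exact abs_sub_le _ _ _
      linarith
    · rw [mem_ball, dist_eq_norm, hxy, norm_smul, Real.norm_of_nonneg hr.le]
      refine mul_lt_mul_of_pos_left ?_ hr
      calc ‖y‖ = ‖y₀ + (y - y₀)‖ := by congr 1; abel
        _ ≤ ‖y₀‖ + ‖y - y₀‖ := norm_add_le _ _
        _ < ρ := by linarith
  set κ : ENNReal := volume (ball (0 : Euc n) δ) / volume (ball (0 : Euc n) ρ) with hκ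
  have hκpos : 0 < κ := ENNReal.div_pos (measure_ball_pos _ _ hδ).ne' measure_ball_lt_top.ne
  have hev := c.eventually_lt_const hκpos
  have htend : Tendsto (fun r : ℝ => r * ρ) (nhdsWithin 0 (Set.Ioi 0))
      (nhdsWithin 0 (Set.Ioi 0)) := by
    refine tendsto_nhdsWithin_iff.mpr ⟨?_, ?_⟩
    · have : Tendsto (fun r : ℝ => r * ρ) (nhds 0) (nhds (0 * ρ)) :=
        (continuous_id.mul continuous_const).tendsto 0
      rw [zero_mul] at this
      exact this.mono_left nhdsWithin_le_nhds
    · filter_upwards [self_mem_nhdsWithin] with r hr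
      exact mul_pos hr hρ
  have hev2 := htend.eventually hev
  have hsmall : ∀ᶠ r : ℝ in nhdsWithin 0 (Set.Ioi 0), 0 < r ∧ r < δ := Ioo_mem_nhdsGT hδ
  obtain ⟨r, hr1, hr, hrδ⟩ := (hev2.and hsmall).exists
  refine absurd hr1 (not_lt.mpr ?_)
  have hκr : κ = volume (ball (x₀ + r • y₀) (r * δ)) / volume (ball x₀ (r * ρ)) := by
    rw [Measure.addHaar_ball_mul_of_pos _ _ hr, Measure.addHaar_ball_mul_of_pos _ _ hr,
      ENNReal.mul_div_mul_left _ _ _ ENNReal.ofReal_ne_top]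
    simp only [ne_eq, ENNReal.ofReal_eq_zero, not_le]
    positivity
  rw [hκr, ← ENNReal.add_div, ← ENNReal.add_div]
  refine ENNReal.div_le_div_right ?_ _
  refine (measure_mono (hlow r hr hrδ)).trans ?_
  rw [Set.union_inter_distrib_right, Set.union_inter_distrib_right, compl_compl, compl_compl]
  refine (measure_union_le _ _).trans ?_
  gcongr
  exact measure_union_le _ _
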